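/- Supremum formula for the pushforward: for a continuous open-dense defined map f : X ⇢ Y between compact metric spaces and any positive strong submeasure μ on X, one has f_*(μ) = sup_{χ ∈ 𝒢(μ)} f_*(χ), where 𝒢(μ) = {χ : χ is a positive measure on X with χ(φ) ≤ μ(φ) for all φ ∈ C⁰(X)}. -/

import Mathlib

open Filter Topology
open scoped Classical

/-- A strong submeasure on a compact metric space `X`: a sublinear and bounded
functional on `C(X, ℝ)`. -/
def IsStrongSubmeasure {X : Type*} [TopologicalSpace X] [CompactSpace X] (μ : C(X, ℝ) → ℝ) : Prop :=
  (∀ φ ψ : C(X, ℝ), μ (φ + ψ) ≤ μ φ + μ ψ) ∧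
  (∀ c : ℝ, 0 ≤ c → ∀ φ : C(X, ℝ), μ (c • φ) = c * μ φ) ∧
  (∃ C : ℝ, 0 < C ∧ ∀ φ : C(X, ℝ), |μ φ| ≤ C * ‖φ‖)

/-- The canonical extension of a function from a dense open set `U` to `X`:
equal to the function on `U`, and to its `limsup` within `U` outside `U`. -/
noncomputable def usce {X : Type*} [TopologicalSpace X] (U : Set X) (g : X → ℝ) : X → ℝ :=
  fun x => if x ∈ U then g x else Filter.limsup g (nhdsWithin x U)

/-- The upper-semicontinuous pullback `f^*(φ)` of a continuous function `φ` by a map `f`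
continuous on the dense open set `U`: the USC extension of `φ ∘ f` from `U`. -/
noncomputable def uscPullback {X Y : Type*} [TopologicalSpace X] [TopologicalSpace Y]
    (U : Set X) (f : X → Y) (φ : C(Y, ℝ)) : X → ℝ :=
  usce U (fun x => φ (f x))

/-- The pushforward `f_*(μ)` of a functional `μ` on `C(X, ℝ)` by a continuous
open-dense defined map: `f_*(μ)(φ) = inf {μ(ψ) : ψ ∈ C⁰(X), ψ ≥ f^*(φ)}`. -/
noncomputable def pushSM {X Y : Type*} [TopologicalSpace X] [CompactSpace X]
    [TopologicalSpace Y] [CompactSpace Y] (U : Set X) (f : X → Y)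
    (μ : C(X, ℝ) → ℝ) (φ : C(Y, ℝ)) : ℝ :=
  sInf {c : ℝ | ∃ ψ : C(X, ℝ), (∀ x, uscPullback U f φ x ≤ ψ x) ∧ μ ψ = c}

open scoped Pointwise in
/-- A form of the Mazur–Orlicz theorem: if a sublinear functional `N` is at least `m` on a convex
set `S`, then some linear functional dominated by `N` is at least `m` on `S`. -/
theorem exists_linear_le_sublinear_of_le_on_convex {E : Type*} [AddCommGroup E] [Module ℝ E]
    (N : E → ℝ) (N_hom : ∀ c : ℝ, 0 ≤ c → ∀ x, N (c • x) = c * N x)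
    (N_add : ∀ x y, N (x + y) ≤ N x + N y) {S : Set E} (hS : Convex ℝ S) (hne : S.Nonempty)
    {m : ℝ} (hm : ∀ s ∈ S, m ≤ N s) :
    ∃ g : E →ₗ[ℝ] ℝ, (∀ x, g x ≤ N x) ∧ ∀ s ∈ S, m ≤ g s := by
  have N_zero : N 0 = 0 := by simpa using N_hom 0 le_rfl 0
  obtain ⟨s₀, hs₀⟩ := hne
  let F : E → Set.Ici (0 : ℝ) × S → ℝ := fun x p => N (x + (p.1 : ℝ) • (p.2 : E)) - p.1 * m
  have : Nonempty (Set.Ici (0 : ℝ) × S) := ⟨⟨0, Set.mem_Ici.2 le_rfl⟩, ⟨s₀, hs₀⟩⟩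
  have F_bdd (x : E) : BddBelow (Set.range (F x)) := by
    refine ⟨-N (-x), ?_⟩
    rintro _ ⟨⟨⟨t, ht⟩, ⟨s, hs⟩⟩, rfl⟩
    have h₁ := N_add (x + t • s) (-x)
    rw [add_neg_cancel_comm, N_hom t ht] at h₁
    have h₂ := mul_le_mul_of_nonneg_left (hm s hs) ht
    simp only [F]
    linarith
  let q : E → ℝ := fun x => ⨅ p, F x p
  have q_le (x : E) {t : ℝ} (ht : 0 ≤ t) {s : E} (hs : s ∈ S) : q x ≤ N (x + t • s) - t * m :=
    ciInf_le (F_bdd x) ⟨⟨t, ht⟩, ⟨s, hs⟩⟩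
  have q_smul_le (c : ℝ) (hc : 0 < c) (x : E) : q (c • x) ≤ c * q x := by
    rw [← div_le_iff₀' hc]
    refine le_ciInf ?_
    rintro ⟨⟨t, ht⟩, ⟨s, hs⟩⟩
    rw [div_le_iff₀' hc]
    refine (q_le (c • x) (mul_nonneg hc.le ht) hs).trans_eq ?_
    simp only [F]
    rw [mul_smul, ← smul_add, N_hom c hc.le]
    ring
  have q_hom (c : ℝ) (hc : 0 < c) (x : E) : q (c • x) = c * q x := by
    refine le_antisymm (q_smul_le c hc x) ?_
    have h := q_smul_le c⁻¹ (inv_pos.2 hc) (c • x)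
    rwa [inv_smul_smul₀ hc.ne', ← div_eq_inv_mul, le_div_iff₀' hc] at h
  have q_add (x y : E) : q (x + y) ≤ q x + q y := by
    refine le_ciInf_add_ciInf ?_
    rintro ⟨⟨t, ht⟩, ⟨s, hs⟩⟩ ⟨⟨u, hu⟩, ⟨r, hr⟩⟩
    obtain ⟨w, hw, hwe⟩ : t • s + u • r ∈ (t + u) • S := by
      rw [hS.add_smul ht hu]
      exact Set.add_mem_add (Set.smul_mem_smul_set hs) (Set.smul_mem_smul_set hr)
    have hwe : (t + u) • w = t • s + u • r := hwe
    have h₁ := q_le (x + y) (add_nonneg ht hu) hw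
    rw [hwe, add_add_add_comm] at h₁
    have h₂ := N_add (x + t • s) (y + u • r)
    simp only [F]
    linarith
  obtain ⟨g, -, hg⟩ := exists_extension_of_le_sublinear (⊥ : E →ₗ.[ℝ] ℝ) q q_hom q_add (by
    intro x
    obtain rfl : x = 0 := Subtype.ext x.2
    have h := q_hom 2 two_pos 0
    rw [smul_zero] at h
    rw [LinearPMap.map_zero, ZeroMemClass.coe_zero]
    linarith)
  refine ⟨g, fun x => ?_, fun s hs => ?_⟩
  · simpa using (hg x).trans (q_le x le_rfl hs₀)
  · have h := (hg (-s)).trans (q_le (-s) zero_le_one hs)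
    simp only [map_neg, one_smul, neg_add_cancel, N_zero, one_mul] at h
    linarith

open MeasureTheory in
/-- Riesz–Markov–Kakutani on a compact space: a positive linear functional on `C(X, ℝ)` is
integration against a finite Borel measure. -/
theorem exists_isFiniteMeasure_integral_eq {X : Type*} [TopologicalSpace X] [T2Space X]
    [CompactSpace X] [MeasurableSpace X] [BorelSpace X] (g : C(X, ℝ) →ₗ[ℝ] ℝ)
    (hg : ∀ ψ, 0 ≤ ψ → 0 ≤ g ψ) :
    ∃ χ : Measure X, IsFiniteMeasure χ ∧ ∀ ψ : C(X, ℝ), ∫ x, ψ x ∂χ = g ψ := by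
  let Λ : CompactlySupportedContinuousMap X ℝ →ₚ[ℝ] ℝ := PositiveLinearMap.mk₀
    { toFun := fun ψ => g (ψ : C(X, ℝ))
      map_add' := fun ψ ρ => g.map_add ψ ρ
      map_smul' := fun c ψ => g.map_smul c ψ }
    (fun ψ hψ => hg ψ hψ)
  exact ⟨RealRMK.rieszMeasure Λ, inferInstance, fun ψ =>
    RealRMK.integral_rieszMeasure Λ (CompactlySupportedContinuousMap.continuousMapEquiv ψ)⟩

/-- The pullback of `φ` along a densely defined map takes values in `[-‖φ‖, ‖φ‖]`. -/
theorem abs_uscPullback_le {X Y : Type*} [TopologicalSpace X] [TopologicalSpace Y]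
    [CompactSpace Y] {U : Set X} (hUd : Dense U) (f : X → Y) (φ : C(Y, ℝ)) (x : X) :
    |uscPullback U f φ x| ≤ ‖φ‖ := by
  have hφ (z : X) : |φ (f z)| ≤ ‖φ‖ := φ.norm_coe_le_norm (f z)
  unfold uscPullback usce
  split_ifs
  · exact hφ x
  · have : (𝓝[U] x).NeBot := mem_closure_iff_nhdsWithin_neBot.1 (hUd x)
    have hle : (𝓝[U] x).IsBoundedUnder (· ≤ ·) fun z => φ (f z) :=
      isBoundedUnder_of ⟨‖φ‖, fun z => (abs_le.1 (hφ z)).2⟩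
    have hge : (𝓝[U] x).IsBoundedUnder (· ≥ ·) fun z => φ (f z) :=
      isBoundedUnder_of ⟨-‖φ‖, fun z => (abs_le.1 (hφ z)).1⟩
    rw [abs_le]
    exact ⟨le_limsup_of_frequently_le (Frequently.of_forall fun z => (abs_le.1 (hφ z)).1) hle,
      limsup_le_of_le hge.isCoboundedUnder_le (Eventually.of_forall fun z => (abs_le.1 (hφ z)).2)⟩

open MeasureTheory in
/-- Supremum formula for the pushforward: `f_*(μ)` is the pointwise supremum of
`f_*(χ)` over all positive (finite Borel) measures `χ ≤ μ`. -/
theorem pushSM_eq_sup_measures {X Y : Type*} [MetricSpace X] [CompactSpace X]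
    [Nonempty X] [MeasurableSpace X] [BorelSpace X] [MetricSpace Y] [CompactSpace Y]
    (U : Set X) (hU : IsOpen U) (hUd : Dense U) (f : X → Y) (hf : ContinuousOn f U)
    (μ : C(X, ℝ) → ℝ) (hμ : IsStrongSubmeasure μ) (hmono : Monotone μ) :
    ∀ φ : C(Y, ℝ), pushSM U f μ φ =
      sSup {c : ℝ | ∃ χ : Measure X, IsFiniteMeasure χ ∧
        (∀ ψ : C(X, ℝ), ∫ x, ψ x ∂χ ≤ μ ψ) ∧
        pushSM U f (fun ψ => ∫ x, ψ x ∂χ) φ = c} := by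
  intro φ
  obtain ⟨μ_add, μ_hom, -⟩ := hμ
  have μ_zero : μ 0 = 0 := by simpa using μ_hom 0 le_rfl 0
  let S : Set C(X, ℝ) := {ψ | ∀ x, uscPullback U f φ x ≤ ψ x}
  have hS : Convex ℝ S := by
    intro ψ hψ ρ hρ a b ha hb hab x
    calc uscPullback U f φ x
        = a * uscPullback U f φ x + b * uscPullback U f φ x := by rw [← add_mul, hab, one_mul]
      _ ≤ a * ψ x + b * ρ x :=
        add_le_add (mul_le_mul_of_nonneg_left (hψ x) ha) (mul_le_mul_of_nonneg_left (hρ x) hb)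
  have hne : S.Nonempty :=
    ⟨ContinuousMap.const X ‖φ‖, fun x => (abs_le.1 (abs_uscPullback_le hUd f φ x)).2⟩
  have const_le {ψ : C(X, ℝ)} (hψ : ψ ∈ S) : ContinuousMap.const X (-‖φ‖) ≤ ψ := fun x =>
    (abs_le.1 (abs_uscPullback_le hUd f φ x)).1.trans (hψ x)
  have push_eq (ν : C(X, ℝ) → ℝ) : pushSM U f ν φ = sInf (ν '' S) := rfl
  have bdd (ν : C(X, ℝ) → ℝ) (hν : Monotone ν) : BddBelow (ν '' S) := by
    refine ⟨ν (ContinuousMap.const X (-‖φ‖)), ?_⟩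
    rintro _ ⟨ψ, hψ, rfl⟩
    exact hν (const_le hψ)
  refine (IsGreatest.csSup_eq ⟨?_, ?_⟩).symm
  · obtain ⟨g, hgμ, hgS⟩ := exists_linear_le_sublinear_of_le_on_convex μ μ_hom μ_add hS hne
      fun ψ hψ => csInf_le (bdd μ hmono) (Set.mem_image_of_mem μ hψ)
    obtain ⟨χ, hχ, hχg⟩ := exists_isFiniteMeasure_integral_eq g fun ψ hψ => by
      have h := (hgμ (-ψ)).trans (hmono (neg_nonpos.2 hψ))
      rw [map_neg, μ_zero] at h
      linarith
    simp only [← hχg] at hgμ hgS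
    refine ⟨χ, hχ, hgμ, ?_⟩
    rw [push_eq, push_eq]
    refine le_antisymm ?_ ?_
    · refine le_csInf (hne.image μ) ?_
      rintro _ ⟨ψ, hψ, rfl⟩
      refine (csInf_le ⟨sInf (μ '' S), ?_⟩ (Set.mem_image_of_mem _ hψ)).trans (hgμ ψ)
      rintro _ ⟨ρ, hρ, rfl⟩
      exact hgS ρ hρ
    · refine le_csInf (hne.image _) ?_
      rintro _ ⟨ψ, hψ, rfl⟩
      exact hgS ψ hψ
  · rintro _ ⟨χ, hχ, hχμ, rfl⟩
    have χ_mono : Monotone fun ψ : C(X, ℝ) => ∫ x, ψ x ∂χ := fun ψ ρ h =>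
      integral_mono (ψ.continuous.integrable_of_hasCompactSupport (.of_compactSpace _))
        (ρ.continuous.integrable_of_hasCompactSupport (.of_compactSpace _)) h
    rw [push_eq, push_eq]
    refine le_csInf (hne.image μ) ?_
    rintro _ ⟨ψ, hψ, rfl⟩
    exact (csInf_le (bdd _ χ_mono) (Set.mem_image_of_mem _ hψ)).trans (hχμ ψ)
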